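/- (Sparse matrix Handelman Positivstellensatz) Let [n] = I_1 ∪ ... ∪ I_t be a cover of the index set satisfying the running intersection property: for every i ∈ {2,...,t} there exists k ∈ {1,...,i−1} with I_i ∩ (I_1 ∪ ... ∪ I_{i−1}) ⊆ I_k. For each i, let G_i(x) be a q_i × q_i symmetric matrix whose entries are affine (degree ≤ 1) polynomials depending only on the variables x(I_i) = (x_j)_{j ∈ I_i}, and suppose each K_i = {x : G_i(x) ⪰ 0} is compact with nonempty interior (as a subset of ℝ^{|I_i|}). Let K = {x ∈ ℝ^n : G_i(x) ⪰ 0 for all i = 1,...,t}. Let f = Σ_{i=1}^t f_i where each f_i ∈ ℝ[x(I_i)]. If f(x) > 0 for all x ∈ K, then f ∈ Σ_{i=1}^t H(G_i); that is, f = Σ_{i=1}^t h_i where each h_i is of the form λ_0^{(i)} + Σ_{k=1}^{m_i} ⟨Λ_k^{(i)}, G_i(x)^{⊗k}⟩ with λ_0^{(i)} ≥ 0 real and each Λ_k^{(i)} a q_i^k × q_i^k positive semidefinite real matrix. -/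

import Mathlib

open scoped BigOperators

noncomputable section

/-- The `k`-fold Kronecker power of a matrix, with rows and columns indexed by
functions `Fin k → ι` (a type of cardinality `(#ι)^k`):
`(M^{⊗k})_{a,b} = ∏ᵢ M_{a i, b i}`. -/
def kronPow {ι : Type*} {R : Type*} [CommMonoid R] (M : Matrix ι ι R) (k : ℕ) :
    Matrix (Fin k → ι) (Fin k → ι) R :=
  Matrix.of fun a b => ∏ i, M (a i) (b i)

/-- Trace inner product `⟨Λ, B⟩ = tr(Λᵀ B) = ∑ᵢⱼ Λᵢⱼ Bᵢⱼ` of a real matrix against a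
polynomial matrix. -/
def tipP {n : ℕ} {ι : Type*} [Fintype ι] (Λ : Matrix ι ι ℝ)
    (B : Matrix ι ι (MvPolynomial (Fin n) ℝ)) : MvPolynomial (Fin n) ℝ :=
  ∑ i, ∑ j, MvPolynomial.C (Λ i j) * B i j

/-- The cone `H(G)` of all polynomials of the form
`λ₀ + ∑_{k=1}^m ⟨Λ_k, G(x)^{⊗k}⟩` with `λ₀ ≥ 0` and each `Λ_k` positive semidefinite. -/
def Hset {n : ℕ} {ι : Type*} [Fintype ι]
    (G : Matrix ι ι (MvPolynomial (Fin n) ℝ)) : Set (MvPolynomial (Fin n) ℝ) :=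
  { p | ∃ (m : ℕ) (lam0 : ℝ) (Λ : (k : ℕ) → Matrix (Fin k → ι) (Fin k → ι) ℝ),
      0 ≤ lam0 ∧ (∀ k ∈ Finset.Icc 1 m, (Λ k).PosSemidef) ∧
      p = MvPolynomial.C lam0 + ∑ k ∈ Finset.Icc 1 m, tipP (Λ k) (kronPow G k) }

/-- Entrywise evaluation of a polynomial matrix at a point `x`. -/
def evalMat {n : ℕ} {ι : Type*} (x : Fin n → ℝ)
    (B : Matrix ι ι (MvPolynomial (Fin n) ℝ)) : Matrix ι ι ℝ :=
  Matrix.of fun i j => MvPolynomial.eval x (B i j)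

/-- The set `K_i = {y ∈ ℝ^{I} : G_i(y) ⪰ 0}`, viewed as a subset of `ℝ^{|I|}` (the
coordinates outside `I`, on which `G_i` does not depend, are filled with `0`). -/
def Kres {n qi : ℕ} (I : Finset (Fin n))
    (Gi : Matrix (Fin qi) (Fin qi) (MvPolynomial (Fin n) ℝ)) :
    Set ({j // j ∈ I} → ℝ) :=
  {y | (evalMat (fun j => if h : j ∈ I then y ⟨j, h⟩ else 0) Gi).PosSemidef}


section Cone

variable {n : ℕ} {ι : Type*} [Fintype ι] {G : Matrix ι ι (MvPolynomial (Fin n) ℝ)}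

theorem C_mem_Hset {c : ℝ} (hc : 0 ≤ c) : MvPolynomial.C c ∈ Hset G :=
  ⟨0, c, 0, hc, by simp, by simp⟩

theorem tipP_zero (B : Matrix ι ι (MvPolynomial (Fin n) ℝ)) : tipP 0 B = 0 := by
  simp [tipP]

theorem tipP_add (Λ Λ' : Matrix ι ι ℝ) (B : Matrix ι ι (MvPolynomial (Fin n) ℝ)) :
    tipP (Λ + Λ') B = tipP Λ B + tipP Λ' B := by
  simp [tipP, add_mul, Finset.sum_add_distrib]

theorem tipP_smul (c : ℝ) (Λ : Matrix ι ι ℝ) (B : Matrix ι ι (MvPolynomial (Fin n) ℝ)) :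
    tipP (c • Λ) B = MvPolynomial.C c * tipP Λ B := by
  simp [tipP, Finset.mul_sum, mul_assoc]

theorem tipP_kronPow_mem_Hset {k : ℕ} (hk : 1 ≤ k) {Λ : Matrix (Fin k → ι) (Fin k → ι) ℝ}
    (hΛ : Λ.PosSemidef) : tipP Λ (kronPow G k) ∈ Hset G := by
  classical
  have hsingle : ∀ j ≠ k, Pi.single (M := fun k => Matrix (Fin k → ι) (Fin k → ι) ℝ) k Λ j = 0 :=
    fun j hj => Pi.single_eq_of_ne (M := fun k => Matrix (Fin k → ι) (Fin k → ι) ℝ) hj Λ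
  refine ⟨k, 0, Pi.single k Λ, le_rfl, fun j _ => ?_, ?_⟩
  · rcases eq_or_ne j k with rfl | hj
    · rwa [Pi.single_eq_same]
    · rw [hsingle j hj]; exact .zero
  · rw [Finset.sum_eq_single_of_mem k (by simp [hk]) fun j _ hj => by rw [hsingle j hj, tipP_zero],
      Pi.single_eq_same]
    simp

/-- The coefficient matrices of an element of `Hset G` can be padded by zero. -/
theorem exists_of_mem_Hset {p : MvPolynomial (Fin n) ℝ} (hp : p ∈ Hset G) :
    ∃ m : ℕ, ∀ M ≥ m, ∃ (c : ℝ) (Λ : (k : ℕ) → Matrix (Fin k → ι) (Fin k → ι) ℝ),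
      0 ≤ c ∧ (∀ k, (Λ k).PosSemidef) ∧
      p = MvPolynomial.C c + ∑ k ∈ Finset.Icc 1 M, tipP (Λ k) (kronPow G k) := by
  obtain ⟨m, c, Λ, hc, hΛ, rfl⟩ := hp
  refine ⟨m, fun M hM => ⟨c, fun k => if k ∈ Finset.Icc 1 m then Λ k else 0, hc, fun k => ?_, ?_⟩⟩
  · beta_reduce
    split_ifs with hk
    exacts [hΛ k hk, .zero]
  · congr 1
    rw [← Finset.sum_subset (Finset.Icc_subset_Icc_right hM)]
    · exact Finset.sum_congr rfl fun k hk => by beta_reduce; rw [if_pos hk]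
    · intro k _ hk
      beta_reduce
      rw [if_neg hk, tipP_zero]

theorem add_mem_Hset {p q : MvPolynomial (Fin n) ℝ} (hp : p ∈ Hset G) (hq : q ∈ Hset G) :
    p + q ∈ Hset G := by
  obtain ⟨m, hm⟩ := exists_of_mem_Hset hp
  obtain ⟨m', hm'⟩ := exists_of_mem_Hset hq
  obtain ⟨c, Λ, hc, hΛ, rfl⟩ := hm (max m m') (le_max_left _ _)
  obtain ⟨c', Λ', hc', hΛ', rfl⟩ := hm' (max m m') (le_max_right _ _)
  refine ⟨max m m', c + c', fun k => Λ k + Λ' k, by positivity,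
    fun k _ => (hΛ k).add (hΛ' k), ?_⟩
  simp only [tipP_add, Finset.sum_add_distrib, map_add]
  ring

theorem sum_mem_Hset {α : Type*} (s : Finset α) {p : α → MvPolynomial (Fin n) ℝ}
    (hp : ∀ a ∈ s, p a ∈ Hset G) : ∑ a ∈ s, p a ∈ Hset G :=
  Finset.sum_induction p (· ∈ Hset G) (fun _ _ => add_mem_Hset)
    (by simpa using C_mem_Hset (G := G) le_rfl) hp

theorem tipP_kronPow_mul {k l : ℕ} (Λ : Matrix (Fin k → ι) (Fin k → ι) ℝ)
    (Λ' : Matrix (Fin l → ι) (Fin l → ι) ℝ) :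
    tipP Λ (kronPow G k) * tipP Λ' (kronPow G l) =
      tipP ((Matrix.kronecker Λ Λ').submatrix (Fin.appendEquiv k l).symm
        (Fin.appendEquiv k l).symm) (kronPow G (k + l)) := by
  have hl : ∀ (a : Fin k → ι) (b : Fin l → ι) i,
      Fin.appendEquiv k l (a, b) (Fin.castAdd l i) = a i := fun a b i => Fin.append_left a b i
  have hr : ∀ (a : Fin k → ι) (b : Fin l → ι) i,
      Fin.appendEquiv k l (a, b) (Fin.natAdd k i) = b i := fun a b i => Fin.append_right a b i
  simp only [tipP]
  rw [← (Fin.appendEquiv k l).sum_comp, Fintype.sum_prod_type, Finset.sum_mul_sum]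
  refine Finset.sum_congr rfl fun a _ => Finset.sum_congr rfl fun a' _ => ?_
  rw [← (Fin.appendEquiv k l).sum_comp, Fintype.sum_prod_type, Finset.sum_mul_sum]
  refine Finset.sum_congr rfl fun b _ => Finset.sum_congr rfl fun b' _ => ?_
  simp only [Matrix.submatrix_apply, Equiv.symm_apply_apply, kronPow, Matrix.of_apply,
    Fin.prod_univ_add, Matrix.kronecker, Matrix.kroneckerMap_apply, map_mul, hl, hr]
  ring

theorem tipP_kronPow_mul_mem_Hset {k l : ℕ} (hk : 1 ≤ k)
    {Λ : Matrix (Fin k → ι) (Fin k → ι) ℝ} {Λ' : Matrix (Fin l → ι) (Fin l → ι) ℝ}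
    (hΛ : Λ.PosSemidef) (hΛ' : Λ'.PosSemidef) :
    tipP Λ (kronPow G k) * tipP Λ' (kronPow G l) ∈ Hset G := by
  classical
  rw [tipP_kronPow_mul]
  exact tipP_kronPow_mem_Hset (by omega) ((hΛ.kronecker hΛ').submatrix _)

theorem mul_mem_Hset {p q : MvPolynomial (Fin n) ℝ} (hp : p ∈ Hset G) (hq : q ∈ Hset G) :
    p * q ∈ Hset G := by
  obtain ⟨m, c, Λ, hc, hΛ, rfl⟩ := hp
  obtain ⟨m', c', Λ', hc', hΛ', rfl⟩ := hq
  rw [add_mul, mul_add, mul_add, ← map_mul, Finset.sum_mul_sum, Finset.mul_sum, Finset.sum_mul]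
  refine add_mem_Hset (add_mem_Hset (C_mem_Hset (by positivity)) (sum_mem_Hset _ fun k hk => ?_))
    (add_mem_Hset (sum_mem_Hset _ fun k hk => ?_)
      (sum_mem_Hset _ fun k hk => sum_mem_Hset _ fun l hl => ?_))
  · rw [← tipP_smul]
    exact tipP_kronPow_mem_Hset (Finset.mem_Icc.1 hk).1 ((hΛ' k hk).smul hc)
  · rw [mul_comm, ← tipP_smul]
    exact tipP_kronPow_mem_Hset (Finset.mem_Icc.1 hk).1 ((hΛ k hk).smul hc')
  · exact tipP_kronPow_mul_mem_Hset (Finset.mem_Icc.1 hk).1 (hΛ k hk) (hΛ' l hl)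

/-- The cone `Hset G` as a semiring of polynomials. -/
def HSemiring (G : Matrix ι ι (MvPolynomial (Fin n) ℝ)) :
    Subsemiring (MvPolynomial (Fin n) ℝ) where
  carrier := Hset G
  mul_mem' := mul_mem_Hset
  one_mem' := by simpa using C_mem_Hset (G := G) zero_le_one
  add_mem' := add_mem_Hset
  zero_mem' := by simpa using C_mem_Hset (G := G) le_rfl

/-- Pairings of the matrix itself with positive semidefinite matrices lie in `Hset G`. -/
theorem tipP_mem_Hset {Λ : Matrix ι ι ℝ} (hΛ : Λ.PosSemidef) : tipP Λ G ∈ Hset G := by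
  have h : tipP Λ G = tipP (Λ.submatrix (Equiv.funUnique (Fin 1) ι) (Equiv.funUnique (Fin 1) ι))
      (kronPow G 1) := by
    simp only [tipP]
    rw [← (Equiv.funUnique (Fin 1) ι).sum_comp]
    refine Finset.sum_congr rfl fun a _ => ?_
    rw [← (Equiv.funUnique (Fin 1) ι).sum_comp]
    simp [kronPow]
  rw [h]
  exact tipP_kronPow_mem_Hset le_rfl (hΛ.submatrix _)

end Cone

theorem PointedCone.exists_ne_zero_forall_nonneg {V : Type*} [NormedAddCommGroup V]
    [NormedSpace ℝ V] [FiniteDimensional ℝ V] (P : PointedCone ℝ V) {w : V} (hw : w ∉ P) :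
    ∃ L : V →ₗ[ℝ] ℝ, L ≠ 0 ∧ ∀ x ∈ P, 0 ≤ L x := by
  have hsmul : ∀ c : ℝ, 0 ≤ c → ∀ x ∈ P, c • x ∈ P := fun c hc x hx =>
    Submodule.smul_mem P (⟨c, hc⟩ : {c : ℝ // 0 ≤ c}) hx
  have hconv : Convex ℝ (P : Set V) := by
    intro x hx y hy a b ha hb _
    exact P.add_mem (hsmul a ha x hx) (hsmul b hb y hy)
  by_cases hPint : (interior (P : Set V)).Nonempty
  · obtain ⟨g, u, hg, hgP, hgw⟩ := geometric_hahn_banach_of_nonempty_interior hconv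
      (convex_singleton w)
      (Set.disjoint_singleton_right.2 fun h => hw (interior_subset h)) hPint
      (Set.singleton_nonempty w)
    refine ⟨-(g : V →ₗ[ℝ] ℝ), ?_, fun x hx => ?_⟩
    · rw [neg_ne_zero]
      exact fun h => hg (by ext x; exact LinearMap.congr_fun h x)
    · by_contra! hneg
      have hpos : 0 < g x := by simpa using hneg
      have hu : 0 ≤ u := by simpa using hgP 0 P.zero_mem
      have := hgP (((u + 1) / g x) • x) (hsmul _ (by positivity) x hx)
      rw [map_smul, smul_eq_mul, div_mul_cancel₀ _ hpos.ne'] at this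
      linarith
  · have hspan : Submodule.span ℝ (P : Set V) ≠ ⊤ := by
      intro h
      apply hPint
      rw [hconv.interior_nonempty_iff_affineSpan_eq_top]
      have h0 : (0 : V) ∈ affineSpan ℝ (P : Set V) := subset_affineSpan ℝ _ P.zero_mem
      have hdir : (affineSpan ℝ (P : Set V)).direction = ⊤ := by
        rw [direction_affineSpan, eq_top_iff, ← h]
        refine Submodule.span_mono fun x hx => ?_
        exact ⟨x, hx, 0, P.zero_mem, by simp⟩
      exact (AffineSubspace.direction_eq_top_iff_of_nonempty ⟨0, h0⟩).1 hdir
    obtain ⟨g, hg, hgP⟩ := Submodule.exists_le_ker_of_lt_top _ (lt_top_iff_ne_top.2 hspan)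
    exact ⟨g, hg, fun x hx => (LinearMap.mem_ker.1 (hgP (Submodule.subset_span hx))).ge⟩

theorem exists_posSemidef_pairing_eq {ι σ : Type*} [Fintype ι] [Fintype σ]
    {A : Matrix ι ι ℝ} {B : σ → Matrix ι ι ℝ} (hB : ∀ j, (B j).IsSymm)
    {R : ℝ} (hR : ∀ y : σ → ℝ, (A + ∑ j, y j • B j).PosSemidef → ∀ j, |y j| ≤ R)
    {y₀ : σ → ℝ} (hy₀ : (A + ∑ j, y₀ j • B j).PosSemidef) (u : σ → ℝ) :
    ∃ Λ : Matrix ι ι ℝ, Λ.PosSemidef ∧ ∀ j, ∑ a, ∑ b, Λ a b * B j a b = u j := by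
  classical
  let P : PointedCone ℝ (σ → ℝ) :=
    { carrier := {u | ∃ Λ : Matrix ι ι ℝ, Λ.PosSemidef ∧ ∀ j, ∑ a, ∑ b, Λ a b * B j a b = u j}
      add_mem' := by
        rintro u u' ⟨Λ, hΛ, hu⟩ ⟨Λ', hΛ', hu'⟩
        refine ⟨Λ + Λ', hΛ.add hΛ', fun j => ?_⟩
        simp [add_mul, Finset.sum_add_distrib, hu, hu']
      zero_mem' := ⟨0, .zero, by simp⟩
      smul_mem' := by
        rintro ⟨c, hc⟩ u ⟨Λ, hΛ, hu⟩
        refine ⟨c • Λ, hΛ.smul hc, fun j => ?_⟩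
        change _ = c * u j
        simp [← hu, Finset.mul_sum, mul_assoc] }
  by_contra hu
  obtain ⟨L, hL, hLP⟩ := P.exists_ne_zero_forall_nonneg (w := u) hu
  obtain ⟨v, hv⟩ : ∃ v : σ → ℝ, ∀ u, L u = ∑ j, u j * v j :=
    ⟨fun j => L (Pi.single j 1), fun u => by
      conv_lhs => rw [pi_eq_sum_univ' u]
      simp⟩
  have hv0 : ∃ j, v j ≠ 0 := by
    by_contra! h
    exact hL (LinearMap.ext fun u => by simp [hv, h])
  obtain ⟨j, hj⟩ := hv0
  have hD : (∑ j, v j • B j).PosSemidef := by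
    refine .of_dotProduct_mulVec_nonneg ?_ fun w => ?_
    · rw [Matrix.IsHermitian, Matrix.conjTranspose_eq_transpose_of_trivial,
        Matrix.transpose_sum]
      exact Finset.sum_congr rfl fun j _ => by rw [Matrix.transpose_smul, hB j]
    · have := hLP (fun j => ∑ a, ∑ b, w a * w b * B j a b)
        ⟨_, Matrix.posSemidef_vecMulVec_self_star w, fun j => by simp [Matrix.vecMulVec_apply]⟩
      rw [hv] at this
      refine this.trans_eq (Eq.symm ?_)
      simp only [dotProduct, Matrix.mulVec, Matrix.sum_apply, Matrix.smul_apply, smul_eq_mul,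
        Finset.sum_mul, Finset.mul_sum, Pi.star_apply, star_trivial]
      rw [Finset.sum_comm_cycle]
      refine Finset.sum_congr rfl fun j _ => Finset.sum_congr rfl fun a _ =>
        Finset.sum_congr rfl fun b _ => by ring
  have hv' : 0 < |v j| := abs_pos.2 hj
  have hR0 : 0 ≤ R := (abs_nonneg _).trans (hR y₀ hy₀ j)
  have hs : 0 ≤ (R + |y₀ j| + 1) / |v j| := by positivity
  have hmem := hR (y₀ + ((R + |y₀ j| + 1) / |v j|) • v) (by
    convert hy₀.add (hD.smul hs) using 1
    simp [add_smul, Finset.sum_add_distrib, Finset.smul_sum, smul_smul, add_assoc]) j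
  have h1 : |((R + |y₀ j| + 1) / |v j|) * v j| = R + |y₀ j| + 1 := by
    rw [abs_mul, abs_of_nonneg hs, div_mul_cancel₀ _ hv'.ne']
  have h2 := abs_add_le (y₀ j + ((R + |y₀ j| + 1) / |v j|) * v j) (-y₀ j)
  rw [add_neg_cancel_comm, h1, abs_neg] at h2
  simp only [Pi.add_apply, Pi.smul_apply, smul_eq_mul] at hmem
  linarith

namespace MvPolynomial

theorem eq_C_add_sum_of_totalDegree_le_one {σ : Type*} [Fintype σ] {p : MvPolynomial σ ℝ}
    (hp : p.totalDegree ≤ 1) :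
    p = C (coeff 0 p) + ∑ j, C (coeff (Finsupp.single j 1) p) * X j := by
  classical
  ext d
  simp only [coeff_add, coeff_C, coeff_sum, coeff_C_mul, coeff_X]
  by_cases h0 : d = 0
  · subst h0
    simp
  by_cases h1 : ∃ j, d = Finsupp.single j 1
  · obtain ⟨j, rfl⟩ := h1
    rw [if_neg (Ne.symm h0), Finset.sum_eq_single j]
    · simp
    · intro i _ hij
      rw [if_neg, mul_zero]
      exact fun h => hij ((Finsupp.single_left_inj one_ne_zero).1 h)
    · simp
  · rw [if_neg (Ne.symm h0), Finset.sum_eq_zero, add_zero]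
    · by_contra hd
      have hdeg := (le_totalDegree (mem_support_iff.2 hd)).trans hp
      obtain ⟨j, hj⟩ : ∃ j, d j ≠ 0 := by
        by_contra! h
        exact h0 (Finsupp.ext h)
      refine h1 ⟨j, Finsupp.ext fun i => ?_⟩
      rw [Finsupp.sum_fintype _ _ (by simp)] at hdeg
      rcases eq_or_ne i j with rfl | hij
      · have := Finset.single_le_sum (f := d) (fun _ _ => Nat.zero_le _) (Finset.mem_univ i)
        simp only [Finsupp.single_eq_same]
        omega
      · rw [Finsupp.single_eq_of_ne hij]
        have := Finset.add_le_sum (f := d) (fun _ _ => Nat.zero_le _) (Finset.mem_univ i)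
          (Finset.mem_univ j) hij
        omega
    · intro j _
      rw [if_neg fun h => h1 ⟨j, h.symm⟩, mul_zero]

theorem exists_C_sub_mem_of_forall_X {σ : Type*} (T : Subsemiring (MvPolynomial σ ℝ))
    (hT : ∀ c : ℝ, 0 ≤ c → C c ∈ T) (hadd : ∀ j, ∃ N : ℝ, C N + X j ∈ T)
    (hsub : ∀ j, ∃ N : ℝ, C N - X j ∈ T) (p : MvPolynomial σ ℝ) : ∃ N : ℝ, C N - p ∈ T := by
  suffices h : (∃ N : ℝ, C N + p ∈ T) ∧ ∃ N : ℝ, C N - p ∈ T from h.2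
  have hmono : ∀ {M N : ℝ} {q : MvPolynomial σ ℝ}, M ≤ N → C M + q ∈ T → C N + q ∈ T := by
    intro M N q hMN hq
    convert T.add_mem (hT (N - M) (sub_nonneg.2 hMN)) hq using 1
    rw [map_sub]; ring
  have hcommon : ∀ {q : MvPolynomial σ ℝ}, (∃ N : ℝ, C N + q ∈ T) → (∃ N : ℝ, C N - q ∈ T) →
      ∃ N : ℝ, C N + q ∈ T ∧ C N - q ∈ T := by
    rintro q ⟨M, hM⟩ ⟨N, hN⟩
    refine ⟨max M N, hmono (le_max_left _ _) hM, ?_⟩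
    rw [sub_eq_add_neg] at hN ⊢
    exact hmono (le_max_right _ _) hN
  induction p using MvPolynomial.induction_on with
  | C a =>
    refine ⟨⟨-a, ?_⟩, a, ?_⟩
    · rw [← map_add]; exact hT _ (by simp)
    · rw [← map_sub]; exact hT _ (by simp)
  | add p q hp hq =>
    obtain ⟨⟨M, hM⟩, M', hM'⟩ := hp
    obtain ⟨⟨N, hN⟩, N', hN'⟩ := hq
    refine ⟨⟨M + N, ?_⟩, M' + N', ?_⟩
    · convert T.add_mem hM hN using 1
      rw [map_add]; ring
    · convert T.add_mem hM' hN' using 1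
      rw [map_add]; ring
  | mul_X p j hp =>
    obtain ⟨M, hM, hM'⟩ := hcommon hp.1 hp.2
    obtain ⟨N, hN, hN'⟩ := hcommon (hadd j) (hsub j)
    have hhalf : (C (1 / 2) : MvPolynomial σ ℝ) * 2 = 1 := by
      rw [← map_ofNat C 2, ← map_mul]; norm_num
    have half := hT (1 / 2) (by norm_num)
    refine ⟨⟨M * N, ?_⟩, M * N, ?_⟩
    · convert T.mul_mem half (T.add_mem (T.mul_mem hM hN) (T.mul_mem hM' hN')) using 1
      rw [map_mul]
      linear_combination -(C M * C N + p * X j) * hhalf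
    · convert T.mul_mem half (T.add_mem (T.mul_mem hM hN') (T.mul_mem hM' hN)) using 1
      rw [map_mul]
      linear_combination -(C M * C N - p * X j) * hhalf

end MvPolynomial

/-- If `f` avoids an archimedean semiring, some state is nonpositive at `f`. -/
theorem Subsemiring.exists_state_nonpos_of_notMem {A : Type*} [CommRing A] [Algebra ℝ A]
    (T : Subsemiring A) (hT : ∀ c : ℝ, 0 ≤ c → algebraMap ℝ A c ∈ T)
    (harch : ∀ a, ∃ N : ℝ, algebraMap ℝ A N - a ∈ T) {f : A} (hf : f ∉ T) :
    ∃ L : A →ₗ[ℝ] ℝ, (∀ a ∈ T, 0 ≤ L a) ∧ L 1 = 1 ∧ L f ≤ 0 := by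
  have hsmul : ∀ c : ℝ, 0 ≤ c → ∀ a ∈ T, c • a ∈ T := fun c hc a ha => by
    rw [Algebra.smul_def]; exact T.mul_mem (hT c hc) ha
  have hone : (1 : A) ≠ 0 := fun h => hf (by
    rw [← mul_one f, h, mul_zero]; exact T.zero_mem)
  have hneg : ∀ c : ℝ, c < 0 → algebraMap ℝ A c ∉ T := fun c hc h => by
    obtain ⟨N, hN⟩ := harch (-f)
    have hN' : algebraMap ℝ A (-|N|) ∈ T := by
      have := hsmul (|N| / -c) (by have := abs_nonneg N; apply div_nonneg <;> linarith) _ h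
      rw [Algebra.smul_def, ← map_mul] at this
      convert this using 2
      have := hc.ne
      field_simp
    have h3 := T.add_mem (T.add_mem hN hN') (hT (|N| - N) (by linarith [le_abs_self N]))
    apply hf
    convert h3 using 1
    simp only [map_neg, map_sub]
    ring
  let s : PointedCone ℝ A :=
    { carrier := {a | ∃ t ∈ T, ∃ b : ℝ, 0 ≤ b ∧ a = t - b • f}
      add_mem' := by
        rintro _ _ ⟨t, ht, b, hb, rfl⟩ ⟨t', ht', b', hb', rfl⟩
        exact ⟨t + t', T.add_mem ht ht', b + b', by positivity, by rw [add_smul]; ring⟩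
      zero_mem' := ⟨0, T.zero_mem, 0, le_rfl, by simp⟩
      smul_mem' := by
        rintro ⟨c, hc⟩ _ ⟨t, ht, b, hb, rfl⟩
        refine ⟨c • t, hsmul c hc t ht, c * b, by positivity, ?_⟩
        change c • (t - b • f) = _
        rw [smul_sub, mul_smul] }
  obtain ⟨L, hL, hLs⟩ := riesz_extension s (LinearPMap.mkSpanSingleton (1 : A) (1 : ℝ) hone)
    (by
      rintro ⟨x, hx⟩ hxs
      obtain ⟨c, rfl⟩ := Submodule.mem_span_singleton.1 hx
      have : (LinearPMap.mkSpanSingleton (1 : A) (1 : ℝ) hone) ⟨c • 1, hx⟩ = c • (1 : ℝ) :=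
        LinearPMap.mkSpanSingleton'_apply _ _ _ _ _
      rw [this, smul_eq_mul, mul_one]
      by_contra! hc
      obtain ⟨t, ht, b, hb, h⟩ := hxs
      simp only [] at h
      rcases hb.eq_or_lt with rfl | hb
      · apply hneg c hc
        rw [Algebra.algebraMap_eq_smul_one, h]
        simpa using ht
      · apply hf
        have h2 := hsmul b⁻¹ (by positivity) _ (T.add_mem ht (hT (-c) (by linarith)))
        convert h2 using 1
        rw [Algebra.algebraMap_eq_smul_one, neg_smul, h, ← sub_eq_add_neg, sub_sub_cancel,
          smul_smul, inv_mul_cancel₀ hb.ne', one_smul])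
    (by
      intro y
      obtain ⟨N, hN⟩ := harch (-y)
      refine ⟨⟨N • 1, Submodule.smul_mem _ _ (Submodule.mem_span_singleton_self _)⟩,
        _, hN, 0, le_rfl, ?_⟩
      simp [Algebra.algebraMap_eq_smul_one])
  refine ⟨L, fun a ha => hLs a ⟨a, ha, 0, le_rfl, by simp⟩, ?_, ?_⟩
  · have := hL ⟨1, Submodule.mem_span_singleton_self _⟩
    simp only at this
    rw [this]
    exact LinearPMap.mkSpanSingleton'_apply_self _ _ _ _
  · have := hLs (-f) ⟨0, T.zero_mem, 1, zero_le_one, by simp⟩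
    simpa using this

/-- The states of a semiring `T`, as real functions on the ambient algebra. -/
def Subsemiring.stateSet {A : Type*} [CommRing A] [Algebra ℝ A] (T : Subsemiring A) :
    Set (A → ℝ) :=
  {L | (∀ a b, L (a + b) = L a + L b) ∧ (∀ (c : ℝ) a, L (c • a) = c * L a) ∧
    (∀ a ∈ T, 0 ≤ L a) ∧ L 1 = 1}

theorem Subsemiring.isCompact_stateSet {A : Type*} [CommRing A] [Algebra ℝ A]
    (T : Subsemiring A) (harch : ∀ a, ∃ N : ℝ, algebraMap ℝ A N - a ∈ T) :
    IsCompact T.stateSet := by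
  choose N hN using harch
  have hbox : IsCompact (Set.univ.pi fun a : A => Set.Icc (-N (-a)) (N a)) :=
    isCompact_univ_pi fun a => isCompact_Icc
  refine hbox.of_isClosed_subset ?_ ?_
  · simp only [stateSet, Set.ofPred_and, Set.ofPred_forall]
    refine .inter ?_ (.inter ?_ (.inter ?_ ?_))
    · exact isClosed_iInter fun a => isClosed_iInter fun b =>
        isClosed_eq (by fun_prop) (by fun_prop)
    · exact isClosed_iInter fun a => isClosed_iInter fun b =>
        isClosed_eq (by fun_prop) (by fun_prop)
    · exact isClosed_iInter fun a => isClosed_iInter fun b =>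
        isClosed_le (by fun_prop) (by fun_prop)
    · exact isClosed_eq (by fun_prop) (by fun_prop)
  · rintro L ⟨hadd, hsmul, hpos, h1⟩ a -
    have key : ∀ a, L a ≤ N a := fun a => by
      have := hpos _ (hN a)
      have h2 := hadd (algebraMap ℝ A (N a) - a) a
      rw [sub_add_cancel, Algebra.algebraMap_eq_smul_one, hsmul, h1] at h2
      rw [Algebra.algebraMap_eq_smul_one] at this
      linarith
    have hn : L (-a) = - L a := by rw [← neg_one_smul ℝ a, hsmul]; ring
    exact ⟨by linarith [key (-a)], key a⟩

/-- **Kadison–Dubois representation theorem** for real algebras: an element which is positive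
at every character that is nonnegative on an archimedean semiring lies in that semiring. -/
theorem Subsemiring.mem_of_forall_algHom_pos {A : Type*} [CommRing A] [Algebra ℝ A]
    (T : Subsemiring A) (hT : ∀ c : ℝ, 0 ≤ c → algebraMap ℝ A c ∈ T)
    (harch : ∀ a, ∃ N : ℝ, algebraMap ℝ A N - a ∈ T) {f : A}
    (hf : ∀ φ : A →ₐ[ℝ] ℝ, (∀ a ∈ T, 0 ≤ φ a) → 0 < φ f) : f ∈ T := by
  by_contra hfT
  obtain ⟨L₀, hL₀, hL₀1, hL₀f⟩ := T.exists_state_nonpos_of_notMem hT harch hfT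
  have hL₀S : (L₀ : A → ℝ) ∈ T.stateSet := ⟨by simp, by simp, hL₀, hL₀1⟩
  have hcomp := T.isCompact_stateSet harch
  obtain ⟨m, hmS, hm⟩ := hcomp.exists_isMinOn ⟨_, hL₀S⟩
    (f := fun L : A → ℝ => L f) (by fun_prop)
  have hmin : ∀ L ∈ T.stateSet, m f ≤ L f := fun L hL => hm hL
  have hface : IsCompact (T.stateSet ∩ {L | L f = m f}) :=
    hcomp.inter_right (isClosed_eq (by fun_prop) (by fun_prop))
  obtain ⟨L, ⟨⟨hLS, hLf⟩, hLext⟩⟩ := hface.extremePoints_nonempty ⟨m, hmS, rfl⟩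
  have hLf : L f = m f := hLf
  obtain ⟨hadd, hsmul, hpos, h1⟩ := id hLS
  have hsub : ∀ a b, L (a - b) = L a - L b := fun a b => by
    have := hadd (a - b) b
    rw [sub_add_cancel] at this
    linarith
  have hstate : ∀ u ∈ T, 0 < L u → (fun b => L (u * b) / L u) ∈ T.stateSet := by
    intro u hu hLu
    refine ⟨fun a b => ?_, fun c a => ?_, fun a ha => ?_, ?_⟩
    · simp only [mul_add, hadd, add_div]
    · simp only [mul_smul_comm, hsmul, mul_div_assoc]
    · exact div_nonneg (hpos _ (T.mul_mem hu ha)) hLu.le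
    · simp only [mul_one]; exact div_self hLu.ne'
  have hmulT : ∀ u v, u ∈ T → v ∈ T → 0 < L u → 0 < L v → L u + L v = 1 → u + v = 1 →
      ∀ b, L (u * b) = L u * L b := by
    intro u v hu hv hLu hLv hLuv huv b
    have hu' := hstate u hu hLu
    have hv' := hstate v hv hLv
    have hsum : ∀ b, L (u * b) + L (v * b) = L b := fun b => by
      rw [← hadd, ← add_mul, huv, one_mul]
    have hfu : L (u * f) / L u = m f := by
      have h1 : m f ≤ L (u * f) / L u := hmin _ hu'
      have h2 : m f ≤ L (v * f) / L v := hmin _ hv'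
      have h3 := hsum f
      rw [le_div_iff₀ hLu] at h1
      rw [le_div_iff₀ hLv] at h2
      rw [div_eq_iff hLu.ne']
      have : m f * L u + m f * L v = m f := by rw [← mul_add, hLuv, mul_one]
      linarith
    have hfv : L (v * f) / L v = m f := by
      rw [div_eq_iff hLu.ne'] at hfu
      rw [div_eq_iff hLv.ne']
      have : m f * L u + m f * L v = m f := by rw [← mul_add, hLuv, mul_one]
      linarith [hsum f]
    have := hLext ⟨hu', hfu⟩ ⟨hv', hfv⟩ ⟨L u, L v, hLu, hLv, hLuv, by
      ext b
      simp only [Pi.add_apply, Pi.smul_apply, smul_eq_mul]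
      rw [mul_div_cancel₀ _ hLu.ne', mul_div_cancel₀ _ hLv.ne', hsum]⟩
    have h2 : L (u * b) / L u = L b := congrFun this b
    rw [div_eq_iff hLu.ne'] at h2
    rw [h2, mul_comm]
  have hmul : ∀ a b, L (a * b) = L a * L b := by
    intro a b
    obtain ⟨N₁, hN₁⟩ := harch a
    obtain ⟨N₂, hN₂⟩ := harch (-a)
    obtain ⟨N, hN, hN1, hN2⟩ : ∃ N : ℝ, 0 < N ∧ N₁ + 1 ≤ N ∧ N₂ + 1 ≤ N :=
      ⟨max 1 (max (N₁ + 1) (N₂ + 1)), by positivity, by simp, by simp⟩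
    have hc : (0 : ℝ) ≤ (2 * N)⁻¹ := by positivity
    have hmem : ∀ (c : ℝ) (d : A), c + 1 ≤ N → algebraMap ℝ A c - d ∈ T →
        (2 * N)⁻¹ • (N • 1 - d) ∈ T ∧ 0 < L ((2 * N)⁻¹ • (N • 1 - d)) := by
      intro c d hcN hd
      have e : N • (1 : A) - d = (algebraMap ℝ A c - d) + algebraMap ℝ A (N - c) := by
        simp only [map_sub, Algebra.algebraMap_eq_smul_one]; ring
      constructor
      · rw [Algebra.smul_def, e]
        exact T.mul_mem (hT _ hc) (T.add_mem hd (hT _ (by linarith)))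
      · rw [hsmul, e, hadd, Algebra.algebraMap_eq_smul_one (N - c), hsmul, h1]
        have := hpos _ hd
        have : 0 < (2 * N)⁻¹ := by positivity
        apply mul_pos this
        linarith
    obtain ⟨hu, hLu⟩ := hmem N₁ a hN1 hN₁
    obtain ⟨hv, hLv⟩ := hmem N₂ (-a) hN2 hN₂
    have huv : (2 * N)⁻¹ • (N • (1 : A) - a) + (2 * N)⁻¹ • (N • 1 - -a) = 1 := by
      rw [← smul_add, show N • (1 : A) - a + (N • 1 - -a) = (2 * N) • 1 by
        rw [two_mul, add_smul]; ring, smul_smul, inv_mul_cancel₀ (by positivity), one_smul]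
    have := hmulT _ _ hu hv hLu hLv (by rw [← hadd, huv, h1]) huv b
    simp only [smul_mul_assoc, sub_mul, one_mul, hsmul, hsub, h1] at this
    rw [mul_assoc] at this
    have := mul_left_cancel₀ (by positivity) this
    linarith
  let φ : A →ₐ[ℝ] ℝ :=
    { toFun := L
      map_one' := h1
      map_mul' := hmul
      map_zero' := by simpa using hsmul 0 0
      map_add' := hadd
      commutes' := fun r => by
        rw [Algebra.algebraMap_eq_smul_one, hsmul, h1]; simp }
  have h0 : 0 < L f := hf φ hpos
  have := hmin _ hL₀S
  linarith

namespace MvPolynomial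

theorem eval_eq_of_vars_subset {σ : Type*} {p : MvPolynomial σ ℝ} {I : Finset σ}
    (hp : p.vars ⊆ I) {x y : σ → ℝ} (hxy : ∀ j ∈ I, x j = y j) : eval x p = eval y p :=
  eval₂Hom_congr' rfl (fun j hj _ => hxy j (hp hj)) rfl

theorem totalDegree_rename_of_injective {σ τ R : Type*} [CommSemiring R] {f : σ → τ}
    (hf : Function.Injective f) (p : MvPolynomial σ R) :
    (rename f p).totalDegree = p.totalDegree := by
  classical
  simp only [totalDegree, support_rename_of_injective hf, Finset.sup_image]
  refine Finset.sup_congr rfl fun s _ => ?_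
  exact Finsupp.sum_mapDomain_index (h := fun _ e => e) (fun _ => rfl) fun _ _ _ => rfl

/-- Polynomials are dense in the continuous functions on a compact set. -/
theorem exists_forall_abs_eval_sub_lt {σ : Type*} {K : Set (σ → ℝ)} (hK : IsCompact K)
    {g : (σ → ℝ) → ℝ} (hg : Continuous g) {ε : ℝ} (hε : 0 < ε) :
    ∃ p : MvPolynomial σ ℝ, ∀ x ∈ K, |eval x p - g x| < ε := by
  let Φ : MvPolynomial σ ℝ →ₐ[ℝ] C(σ → ℝ, ℝ) :=
    aeval fun i => ⟨fun x => x i, continuous_apply i⟩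
  have hΦ : ∀ p x, Φ p x = eval x p := by
    intro p x
    induction p using MvPolynomial.induction_on with
    | C a => simp [Φ]
    | add p q hp hq => simp [hp, hq]
    | mul_X p i hp => simp [hp, Φ]
  have hsep : Φ.range.SeparatesPoints := by
    intro x y hxy
    obtain ⟨i, hi⟩ := Function.ne_iff.1 hxy
    exact ⟨Φ (X i), ⟨Φ (X i), ⟨X i, rfl⟩, rfl⟩, by simpa [hΦ] using hi⟩
  obtain ⟨_, ⟨p, rfl⟩, hp⟩ :=
    ContinuousMap.exists_mem_subalgebra_near_continuous_of_isCompact_of_separatesPoints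
      hsep ⟨g, hg⟩ hK hε
  exact ⟨p, fun x hx => by simpa [hΦ] using hp x hx⟩

/-- If `g x + φ z > 0` whenever `x ∈ X` and `z ∈ Y` agree on the coordinates in `J`, then a
polynomial in the variables of `J` fits below `g` on `X` and above `-φ` on `Y`. -/
theorem exists_vars_subset_eval_lt {σ : Type*} [Fintype σ] (J : Finset σ) {X Y : Set (σ → ℝ)}
    (hX : IsCompact X) (hY : IsCompact Y) {g φ : (σ → ℝ) → ℝ} (hg : Continuous g)
    (hφ : Continuous φ)
    (hpos : ∀ x ∈ X, ∀ z ∈ Y, (∀ j ∈ J, x j = z j) → 0 < g x + φ z) :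
    ∃ p : MvPolynomial σ ℝ, p.vars ⊆ J ∧ (∀ x ∈ X, eval x p < g x) ∧
      ∀ z ∈ Y, 0 < φ z + eval z p := by
  classical
  rcases X.eq_empty_or_nonempty with rfl | hXne
  · obtain ⟨c, hc⟩ := (hY.image hφ).bddBelow
    refine ⟨C (1 - c), by simp, by simp, fun z hz => ?_⟩
    have := hc ⟨z, hz, rfl⟩
    rw [eval_C]
    linarith
  let r : (σ → ℝ) → (J → ℝ) := fun x j => x j
  have hr : Continuous r := by fun_prop
  obtain ⟨N, hN⟩ := (hX.prod hY).elim_directed_cover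
    (fun N : ℕ => {w | 1 / ((N : ℝ) + 1) < g w.1 + φ w.2 + N * dist (r w.1) (r w.2)})
    (fun N => isOpen_lt (by fun_prop) (by fun_prop))
    (by
      rintro ⟨x, z⟩ ⟨hx, hz⟩
      rw [Set.mem_iUnion]
      simp only [Set.mem_ofPred_eq]
      rcases (dist_nonneg (x := r x) (y := r z)).eq_or_lt with h0 | h0
      · have hxz := hpos x hx z hz fun j hj => congrFun (dist_eq_zero.1 h0.symm) ⟨j, hj⟩
        obtain ⟨N, hN⟩ := exists_nat_one_div_lt hxz
        exact ⟨N, by rw [← h0]; simpa using hN⟩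
      · obtain ⟨N, hN⟩ := exists_nat_gt ((1 - (g x + φ z)) / dist (r x) (r z))
        rw [div_lt_iff₀ h0] at hN
        refine ⟨N, ?_⟩
        have : 1 / ((N : ℝ) + 1) ≤ 1 := by
          rw [div_le_one (by positivity)]
          linarith [N.cast_nonneg (α := ℝ)]
        linarith)
    (Monotone.directed_le (by
      intro M N hMN w hw
      have hMN' : (M : ℝ) ≤ N := by exact_mod_cast hMN
      have h1 : 1 / ((N : ℝ) + 1) ≤ 1 / ((M : ℝ) + 1) := by gcongr
      have h2 : (M : ℝ) * dist (r w.1) (r w.2) ≤ N * dist (r w.1) (r w.2) := by gcongr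
      simp only [Set.mem_ofPred_eq] at hw ⊢
      linarith))
  set ε : ℝ := 1 / ((N : ℝ) + 1)
  have hε : 0 < ε := by positivity
  let F : (J → ℝ) → (σ → ℝ) → ℝ := fun y x => g x + N * dist (r x) y
  have hF : Continuous ↿F := by
    simp only [F, Function.HasUncurry.uncurry, id]
    fun_prop
  have hFX : ∀ y, IsCompact (F y '' X) := fun y =>
    hX.image (hF.comp (Continuous.prodMk_right y))
  obtain ⟨p, hp⟩ := exists_forall_abs_eval_sub_lt ((hX.image hr).union (hY.image hr))
    ((hX.continuous_sInf hF).sub (continuous_const (y := ε / 2))) (half_pos hε)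
  refine ⟨rename Subtype.val p, ?_, fun x hx => ?_, fun z hz => ?_⟩
  · intro j hj
    obtain ⟨i, -, rfl⟩ := Finset.mem_image.1 (vars_rename _ p hj)
    exact i.2
  · rw [eval_rename]
    have h1 := (abs_lt.1 (hp (r x) (Or.inl ⟨x, hx, rfl⟩))).2
    have h2 : sInf (F (r x) '' X) ≤ g x := by
      refine (csInf_le (hFX _).bddBelow ⟨x, hx, rfl⟩).trans ?_
      simp [F]
    simp only [Pi.sub_apply] at h1
    change eval (r x) p < g x
    linarith
  · rw [eval_rename]
    have h1 := (abs_lt.1 (hp (r z) (Or.inr ⟨z, hz, rfl⟩))).1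
    have h2 : ε - φ z ≤ sInf (F (r z) '' X) := by
      refine le_csInf (hXne.image _) ?_
      rintro _ ⟨x, hx, rfl⟩
      have : ε < g x + φ z + N * dist (r x) (r z) := hN (Set.mk_mem_prod hx hz)
      simp only [F]
      linarith
    simp only [Pi.sub_apply] at h1
    change 0 < φ z + eval (r z) p
    linarith

end MvPolynomial

/-- Matrix Handelman Positivstellensatz for a single bounded nonempty spectrahedron. -/
theorem mem_Hset_of_forall_mem_Kres_pos {n q : ℕ} {I : Finset (Fin n)}
    {G : Matrix (Fin q) (Fin q) (MvPolynomial (Fin n) ℝ)} (hsym : G.IsSymm)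
    (haff : ∀ a b, (G a b).totalDegree ≤ 1) (hvars : ∀ a b, (G a b).vars ⊆ I)
    {R : ℝ} (hR : ∀ y ∈ Kres I G, ∀ j, |y j| ≤ R) (hne : (Kres I G).Nonempty)
    {f : MvPolynomial (Fin n) ℝ} (hf : f.vars ⊆ I)
    (hpos : ∀ y ∈ Kres I G,
      0 < MvPolynomial.eval (fun j => if h : j ∈ I then y ⟨j, h⟩ else 0) f) :
    f ∈ Hset G := by
  classical
  have hinj : Function.Injective
      (MvPolynomial.rename (R := ℝ) (Subtype.val : {j // j ∈ I} → Fin n)) :=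
    MvPolynomial.rename_injective _ Subtype.val_injective
  have hlift : ∀ p : MvPolynomial (Fin n) ℝ, p.vars ⊆ I →
      ∃ p' : MvPolynomial {j // j ∈ I} ℝ, MvPolynomial.rename Subtype.val p' = p := fun p hp =>
    MvPolynomial.exists_rename_eq_of_vars_subset_range p _ Subtype.val_injective
      (by simpa using hp)
  choose G' hG' using fun a b => hlift (G a b) (hvars a b)
  obtain ⟨f', rfl⟩ := hlift f hf
  have heval : ∀ (y : {j // j ∈ I} → ℝ) (p : MvPolynomial {j // j ∈ I} ℝ),
      MvPolynomial.eval (fun j => if h : j ∈ I then y ⟨j, h⟩ else 0)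
        (MvPolynomial.rename Subtype.val p) = MvPolynomial.eval y p := by
    intro y p
    rw [MvPolynomial.eval_rename]
    congr 2
    ext j
    simp
  have hK : ∀ y, y ∈ Kres I G ↔
      (Matrix.of fun a b => MvPolynomial.eval y (G' a b)).PosSemidef := by
    intro y
    simp only [Kres, evalMat, Set.mem_ofPred_eq, ← hG', heval]
  simp only [heval] at hpos
  have hG'sym : ∀ a b, G' a b = G' b a := fun a b => hinj (by rw [hG', hG', hsym.apply])
  have hG'exp : ∀ a b, G' a b = _ := fun a b =>
    MvPolynomial.eq_C_add_sum_of_totalDegree_le_one (p := G' a b) (by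
      rw [← MvPolynomial.totalDegree_rename_of_injective Subtype.val_injective, hG']
      exact haff a b)
  let A : Matrix (Fin q) (Fin q) ℝ := Matrix.of fun a b => MvPolynomial.coeff 0 (G' a b)
  let B : {j // j ∈ I} → Matrix (Fin q) (Fin q) ℝ := fun j =>
    Matrix.of fun a b => MvPolynomial.coeff (Finsupp.single j 1) (G' a b)
  have hAB : ∀ y : {j // j ∈ I} → ℝ,
      (Matrix.of fun a b => MvPolynomial.eval y (G' a b)) = A + ∑ j, y j • B j := by
    intro y
    ext a b
    rw [Matrix.of_apply, hG'exp]
    simp [A, B, Matrix.sum_apply, mul_comm]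
  have hBsym : ∀ j, (B j).IsSymm := fun j => Matrix.IsSymm.ext fun a b => by
    simp only [B, Matrix.of_apply, hG'sym a b]
  obtain ⟨y₀, hy₀⟩ := hne
  rw [hK, hAB] at hy₀
  have hpair := exists_posSemidef_pairing_eq hBsym (R := R)
    (fun y hy => hR y (by rwa [hK, hAB])) hy₀
  let T : Subsemiring (MvPolynomial {j // j ∈ I} ℝ) :=
    (HSemiring G).comap (MvPolynomial.rename (R := ℝ) Subtype.val).toRingHom
  have hTmem : ∀ p, MvPolynomial.rename Subtype.val p ∈ Hset G → p ∈ T := fun p hp => hp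
  have hTC : ∀ c : ℝ, 0 ≤ c → MvPolynomial.C c ∈ T := fun c hc => hTmem _ (by
    rw [MvPolynomial.rename_C]; exact C_mem_Hset hc)
  have hTtip : ∀ Λ : Matrix (Fin q) (Fin q) ℝ, Λ.PosSemidef →
      ∑ a, ∑ b, MvPolynomial.C (Λ a b) * G' a b ∈ T := fun Λ hΛ => hTmem _ (by
    have : tipP Λ G ∈ Hset G := tipP_mem_Hset hΛ
    simpa [tipP, map_sum, hG'] using this)
  have hlin : ∀ u : {j // j ∈ I} → ℝ, ∃ N : ℝ,
      MvPolynomial.C N + ∑ j, MvPolynomial.C (u j) * MvPolynomial.X j ∈ T := by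
    intro u
    obtain ⟨Λ, hΛ, hu⟩ := hpair u
    refine ⟨∑ a, ∑ b, Λ a b * A a b, ?_⟩
    convert hTtip Λ hΛ using 1
    have : ∀ a b, MvPolynomial.C (Λ a b) * G' a b = MvPolynomial.C (Λ a b * A a b) +
        ∑ j, MvPolynomial.C (Λ a b * B j a b) * MvPolynomial.X j := by
      intro a b
      conv_lhs => rw [hG'exp a b]
      simp only [mul_add, Finset.mul_sum, map_mul, A, B, Matrix.of_apply, mul_assoc]
    simp only [this, Finset.sum_add_distrib, ← map_sum]
    congr 1
    simp only [← hu, map_sum, Finset.sum_mul]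
    exact Finset.sum_comm_cycle.symm
  have harch : ∀ p, ∃ N : ℝ, MvPolynomial.C N - p ∈ T := by
    refine MvPolynomial.exists_C_sub_mem_of_forall_X T hTC (fun j => ?_) fun j => ?_
    · obtain ⟨N, hN⟩ := hlin (Pi.single j 1)
      exact ⟨N, by simpa [Pi.single_apply, apply_ite, ite_mul] using hN⟩
    · obtain ⟨N, hN⟩ := hlin (-Pi.single j 1)
      exact ⟨N, by simpa [Pi.single_apply, apply_ite, ite_mul, sub_eq_add_neg] using hN⟩
  refine (T.mem_of_forall_algHom_pos hTC harch fun φ hφ => ?_ : f' ∈ T)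
  have hφe : ∀ p, φ p = MvPolynomial.eval (fun j => φ (MvPolynomial.X j)) p := fun p => by
    conv_lhs => rw [MvPolynomial.aeval_unique φ]
    rfl
  rw [hφe]
  refine hpos _ ((hK _).2 (.of_dotProduct_mulVec_nonneg ?_ fun w => ?_))
  · rw [Matrix.IsHermitian, Matrix.conjTranspose_eq_transpose_of_trivial]
    ext a b
    simp only [Matrix.transpose_apply, Matrix.of_apply, hG'sym a b]
  · have := hφ _ (hTtip _ (Matrix.posSemidef_vecMulVec_self_star w))
    rw [hφe] at this
    refine this.trans_eq ?_
    simp only [map_sum, map_mul, MvPolynomial.eval_C, Matrix.vecMulVec_apply, dotProduct,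
      Matrix.mulVec, Matrix.of_apply, Finset.mul_sum, Pi.star_apply, star_trivial]
    exact Finset.sum_congr rfl fun a _ => Finset.sum_congr rfl fun b _ => by ring

theorem evalMat_eq_of_vars_subset {n : ℕ} {ι : Type*} {I : Finset (Fin n)}
    {G : Matrix ι ι (MvPolynomial (Fin n) ℝ)} (hvars : ∀ a b, (G a b).vars ⊆ I)
    {x y : Fin n → ℝ} (hxy : ∀ j ∈ I, x j = y j) : evalMat x G = evalMat y G := by
  ext a b
  exact MvPolynomial.eval_eq_of_vars_subset (hvars a b) hxy

theorem isClosed_setOf_evalMat_posSemidef {n : ℕ} {ι : Type*} [Fintype ι]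
    {G : Matrix ι ι (MvPolynomial (Fin n) ℝ)} (hsym : G.IsSymm) :
    IsClosed {x : Fin n → ℝ | (evalMat x G).PosSemidef} := by
  have h : ∀ x, (evalMat x G).IsHermitian := fun x => by
    rw [Matrix.IsHermitian, Matrix.conjTranspose_eq_transpose_of_trivial]
    ext a b
    simp only [evalMat, Matrix.transpose_apply, Matrix.of_apply, hsym.apply]
  simp only [Matrix.posSemidef_iff_dotProduct_mulVec, h, true_and, Set.ofPred_forall]
  refine isClosed_iInter fun w => isClosed_le continuous_const ?_
  simp only [dotProduct, Matrix.mulVec, evalMat, Matrix.of_apply]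
  have := fun a b => MvPolynomial.continuous_eval (G a b)
  fun_prop

theorem abs_le_of_evalMat_posSemidef {n q : ℕ} {I : Finset (Fin n)}
    {G : Matrix (Fin q) (Fin q) (MvPolynomial (Fin n) ℝ)} (hvars : ∀ a b, (G a b).vars ⊆ I)
    {R : ℝ} (hR : ∀ y ∈ Kres I G, ∀ j, |y j| ≤ R) {x : Fin n → ℝ}
    (hx : (evalMat x G).PosSemidef) {j : Fin n} (hj : j ∈ I) : |x j| ≤ R := by
  refine hR (fun j => x j) ?_ ⟨j, hj⟩
  rw [Kres, Set.mem_ofPred_eq]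
  rwa [evalMat_eq_of_vars_subset hvars (y := x) fun j hj => by simp [hj]]

/-- The indices below `s`. -/
abbrev initialBlocks (t s : ℕ) : Finset (Fin t) :=
  Finset.univ.filter fun i => (i : ℕ) < s

/-- Sparse Positivstellensatz for the first `s` blocks of a cover with the running intersection
property. -/
theorem exists_mem_Hset_sum_eq {n t : ℕ} {q : Fin t → ℕ} {I : Fin t → Finset (Fin n)}
    (hRIP : ∀ i : Fin t, 0 < (i : ℕ) →
      ∃ k : Fin t, k < i ∧
        I i ∩ (Finset.univ.filter (fun j : Fin t => j < i)).biUnion I ⊆ I k)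
    {G : (i : Fin t) → Matrix (Fin (q i)) (Fin (q i)) (MvPolynomial (Fin n) ℝ)}
    (hsym : ∀ i, (G i).IsSymm)
    (haff : ∀ i a b, ((G i) a b).totalDegree ≤ 1)
    (hvars : ∀ i a b, ((G i) a b).vars ⊆ I i)
    {R : ℝ} (hR0 : 0 ≤ R) (hR : ∀ i, ∀ y ∈ Kres (I i) (G i), ∀ j, |y j| ≤ R)
    (hne : ∀ i, (Kres (I i) (G i)).Nonempty) {s : ℕ} (hs : s ≤ t)
    {f : Fin t → MvPolynomial (Fin n) ℝ} (hf : ∀ i, (f i).vars ⊆ I i)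
    (hpos : ∀ x, (∀ i : Fin t, (i : ℕ) < s → (evalMat x (G i)).PosSemidef) →
      0 < MvPolynomial.eval x (∑ i ∈ initialBlocks t s, f i)) :
    ∃ h : Fin t → MvPolynomial (Fin n) ℝ, (∀ i, h i ∈ Hset (G i)) ∧
      ∑ i ∈ initialBlocks t s, f i = ∑ i ∈ initialBlocks t s, h i := by
  classical
  induction s generalizing f with
  | zero => simpa [initialBlocks] using hpos 0
  | succ s ih =>
    let i₀ : Fin t := ⟨s, hs⟩
    have hlt : ∀ i : Fin t, (i : ℕ) < s + 1 ↔ i = i₀ ∨ (i : ℕ) < s := fun i => by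
      rw [Fin.ext_iff]
      exact Nat.lt_succ_iff_lt_or_eq.trans or_comm
    have hnot : i₀ ∉ initialBlocks t s := by simp [i₀, initialBlocks]
    have hadd : ∀ c : Fin t → MvPolynomial (Fin n) ℝ, ∑ i ∈ initialBlocks t (s + 1), c i =
        c i₀ + ∑ i ∈ initialBlocks t s, c i := fun c => by
      rw [← Finset.sum_insert hnot]
      congr 1
      ext i
      simp [initialBlocks, hlt]
    simp only [hadd, map_add] at hpos ⊢
    suffices ∃ (h : Fin t → MvPolynomial (Fin n) ℝ) (p : MvPolynomial (Fin n) ℝ),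
        (∀ i, h i ∈ Hset (G i)) ∧ p.vars ⊆ I i₀ ∧
        ∑ i ∈ initialBlocks t s, f i = p + ∑ i ∈ initialBlocks t s, h i ∧
        ∀ z, (∀ j, |z j| ≤ R) → (evalMat z (G i₀)).PosSemidef →
          0 < MvPolynomial.eval z (f i₀) + MvPolynomial.eval z p by
      obtain ⟨h, p, hh, hp, hsum, hpos'⟩ := this
      refine ⟨Function.update h i₀ (f i₀ + p), fun i => ?_, ?_⟩
      · rcases eq_or_ne i i₀ with rfl | hi
        · rw [Function.update_self]
          refine mem_Hset_of_forall_mem_Kres_pos (hsym _) (haff _) (hvars _) (hR _) (hne _)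
            ((MvPolynomial.vars_add_subset _ _).trans (Finset.union_subset (hf _) hp))
            fun y hy => ?_
          rw [map_add]
          refine hpos' _ (fun j => ?_) hy
          split_ifs with hj
          · exact hR _ y hy _
          · simpa using hR0
        · rw [Function.update_of_ne hi]
          exact hh i
      · rw [Function.update_self, hsum, Finset.sum_update_of_notMem hnot, add_assoc]
    rcases s.eq_zero_or_pos with hs0 | hs0
    · subst hs0
      refine ⟨0, 0, fun i => by simpa using C_mem_Hset (G := G i) le_rfl, by simp,
        by simp [initialBlocks], fun z _ hz => ?_⟩
      have := hpos z fun i hi => ((hlt i).1 hi).elim (fun h => h ▸ hz) (by simp)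
      simpa [initialBlocks] using this
    let S : Finset (Fin t) := initialBlocks t s
    have hS : ∀ i, i ∈ S ↔ (i : ℕ) < s := fun i => by simp [S, initialBlocks]
    let U : Finset (Fin n) := S.biUnion I
    have hU : ∀ {i : Fin t}, (i : ℕ) < s → I i ⊆ U := fun {i} hi =>
      Finset.subset_biUnion_of_mem I ((hS i).2 hi)
    obtain ⟨k, hki, hk⟩ : ∃ k : Fin t, (k : ℕ) < s ∧ I i₀ ∩ U ⊆ I k := hRIP i₀ hs0
    let box : Set (Fin n → ℝ) := Set.univ.pi fun _ => Set.Icc (-R) R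
    have hbox : IsCompact box := isCompact_univ_pi fun _ => isCompact_Icc
    have hmem_box : ∀ x, x ∈ box ↔ ∀ j, |x j| ≤ R := fun x => by
      simp only [box, Set.mem_univ_pi, Set.mem_Icc, abs_le]
    let X : Set (Fin n → ℝ) := box ∩ ⋂ i ∈ S, {x | (evalMat x (G i)).PosSemidef}
    have hX : IsCompact X := hbox.inter_right <| isClosed_biInter fun i _ =>
      isClosed_setOf_evalMat_posSemidef (hsym i)
    have hY := hbox.inter_right (isClosed_setOf_evalMat_posSemidef (hsym i₀))
    have hglue : ∀ x ∈ X, ∀ z ∈ box ∩ {z | (evalMat z (G i₀)).PosSemidef},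
        (∀ j ∈ I i₀ ∩ U, x j = z j) →
        0 < MvPolynomial.eval x (∑ i ∈ S, f i) + MvPolynomial.eval z (f i₀) := by
      intro x hx z hz hxz
      let w : Fin n → ℝ := fun j => if j ∈ I i₀ then z j else x j
      have hwz : ∀ j ∈ I i₀, w j = z j := fun j hj => if_pos hj
      have hwx : ∀ i : Fin t, (i : ℕ) < s → ∀ j ∈ I i, w j = x j := by
        intro i hi j hj
        simp only [w]
        split_ifs with hj0
        · exact (hxz j (Finset.mem_inter.2 ⟨hj0, hU hi hj⟩)).symm
        · rfl
      have hw := hpos w fun i hi => by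
        rcases (hlt i).1 hi with rfl | hi
        · rw [evalMat_eq_of_vars_subset (hvars _) hwz]
          exact hz.2
        · rw [evalMat_eq_of_vars_subset (hvars _) (hwx i hi)]
          exact Set.mem_iInter₂.1 hx.2 i ((hS i).2 hi)
      rw [MvPolynomial.eval_eq_of_vars_subset (hf i₀) hwz, add_comm] at hw
      refine hw.trans_eq (congrArg (· + _) ?_)
      simp only [map_sum]
      exact Finset.sum_congr rfl fun i hi =>
        MvPolynomial.eval_eq_of_vars_subset (hf i) (hwx i ((hS i).1 hi))
    obtain ⟨p, hpJ, hpX, hpY⟩ := MvPolynomial.exists_vars_subset_eval_lt (I i₀ ∩ U) hX hY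
      (MvPolynomial.continuous_eval _) (MvPolynomial.continuous_eval _) hglue
    have hpU : p.vars ⊆ U := hpJ.trans Finset.inter_subset_right
    let f' : Fin t → MvPolynomial (Fin n) ℝ := Function.update f k (f k - p)
    have hf'sum : ∑ i ∈ S, f' i = ∑ i ∈ S, f i - p := by
      rw [Finset.sum_update_of_mem ((hS k).2 hki),
        Finset.sum_eq_add_sum_sdiff_singleton_of_mem ((hS k).2 hki) f]
      ring
    have hf' : ∀ i, (f' i).vars ⊆ I i := by
      intro i
      rcases eq_or_ne i k with rfl | hi
      · simp only [f', Function.update_self]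
        exact (MvPolynomial.vars_sub_subset _).trans
          (Finset.union_subset (hf i) (hpJ.trans hk))
      · simp only [f', Function.update_of_ne hi, hf i]
    obtain ⟨h, hh, hsum⟩ := ih (by omega) hf' (by
      intro x hx
      change 0 < MvPolynomial.eval x (∑ i ∈ S, f' i)
      let x' : Fin n → ℝ := fun j => if j ∈ U then x j else 0
      have hx' : ∀ i : Fin t, (i : ℕ) < s → ∀ j ∈ I i, x j = x' j := fun i hi j hj =>
        (if_pos (hU hi hj)).symm
      have hx'X : x' ∈ X := by
        refine ⟨(hmem_box _).2 fun j => ?_, Set.mem_iInter₂.2 fun i hi => ?_⟩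
        · simp only [x']
          split_ifs with hj
          · obtain ⟨i, hi, hij⟩ := Finset.mem_biUnion.1 hj
            exact abs_le_of_evalMat_posSemidef (hvars i) (hR i) (hx i ((hS i).1 hi)) hij
          · simpa using hR0
        · rw [Set.mem_ofPred_eq, ← evalMat_eq_of_vars_subset (hvars i) (hx' i ((hS i).1 hi))]
          exact hx i ((hS i).1 hi)
      have hvarsU : (∑ i ∈ S, f' i).vars ⊆ U :=
        (MvPolynomial.vars_sum_subset _ _).trans
          (Finset.biUnion_subset.2 fun i hi => (hf' i).trans (hU ((hS i).1 hi)))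
      rw [MvPolynomial.eval_eq_of_vars_subset hvarsU (y := x') fun j hj => (if_pos hj).symm,
        hf'sum, map_sub]
      exact sub_pos.2 (hpX x' hx'X))
    refine ⟨h, p, hh, hpJ.trans Finset.inter_subset_left, ?_, fun z hz hzG =>
      hpY z ⟨(hmem_box z).2 hz, hzG⟩⟩
    rw [← hsum]
    change _ = p + ∑ i ∈ S, f' i
    rw [hf'sum]
    exact (add_sub_cancel _ _).symm

/-- **Sparse matrix Handelman Positivstellensatz.**
Let `[n] = I₁ ∪ ⋯ ∪ I_t` satisfy the running intersection property, let each `G_i` be a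
symmetric `q_i × q_i` polynomial matrix with affine entries depending only on the
variables in `I_i`, such that each `K_i = {G_i ⪰ 0} ⊆ ℝ^{|I_i|}` is compact with
nonempty interior, and let `K = {x : G_i(x) ⪰ 0, i = 1,…,t}`. If `f = ∑ f_i` with
`f_i ∈ ℝ[x(I_i)]` is positive on `K`, then `f ∈ ∑ᵢ H(G_i)`. -/
theorem sparse_matrix_handelman {n t : ℕ} {q : Fin t → ℕ}
    (I : Fin t → Finset (Fin n))
    (hcover : ∀ j : Fin n, ∃ i, j ∈ I i)
    (hRIP : ∀ i : Fin t, 0 < (i : ℕ) →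
      ∃ k : Fin t, k < i ∧
        I i ∩ (Finset.univ.filter (fun j : Fin t => j < i)).biUnion I ⊆ I k)
    (G : (i : Fin t) → Matrix (Fin (q i)) (Fin (q i)) (MvPolynomial (Fin n) ℝ))
    (hsym : ∀ i, (G i).IsSymm)
    (haff : ∀ i a b, ((G i) a b).totalDegree ≤ 1)
    (hvars : ∀ i a b, ((G i) a b).vars ⊆ I i)
    (hcomp : ∀ i, IsCompact (Kres (I i) (G i)))
    (hint : ∀ i, (interior (Kres (I i) (G i))).Nonempty)
    (K : Set (Fin n → ℝ))
    (hK : K = {x | ∀ i, (evalMat x (G i)).PosSemidef})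
    (f : MvPolynomial (Fin n) ℝ) (fp : Fin t → MvPolynomial (Fin n) ℝ)
    (hfvars : ∀ i, (fp i).vars ⊆ I i)
    (hfsum : f = ∑ i, fp i)
    (hfpos : ∀ x ∈ K, 0 < MvPolynomial.eval x f) :
    ∃ h : Fin t → MvPolynomial (Fin n) ℝ,
      (∀ i, h i ∈ Hset (G i)) ∧ f = ∑ i, h i := by
  have hne : ∀ i, (Kres (I i) (G i)).Nonempty := fun i => (hint i).mono interior_subset
  choose R hR using fun i => (hcomp i).isBounded.exists_norm_le
  have hle : ∀ i, R i ≤ ∑ i, |R i| := fun i => (le_abs_self _).trans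
    (Finset.single_le_sum (f := fun i => |R i|) (fun i _ => abs_nonneg _) (Finset.mem_univ i))
  have huniv : initialBlocks t t = Finset.univ := by simp
  obtain ⟨h, hh, hsum⟩ := exists_mem_Hset_sum_eq hRIP hsym haff hvars
    (Finset.sum_nonneg fun i _ => abs_nonneg (R i))
    (fun i y hy j => (norm_le_pi_norm y j).trans ((hR i y hy).trans (hle i))) hne le_rfl hfvars
    (fun x hx => by
      rw [huniv, ← hfsum]
      exact hfpos x (hK ▸ fun i => hx i i.2))
  rw [huniv] at hsum
  exact ⟨h, hh, hfsum.trans hsum⟩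

end
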